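/- Under the hypotheses: s+1 ≤ γ ≤ γ₀ and 𝓘^γ(0,S) < +∞, one has: (i) for all t ∈ ℝ, n ∈ ℕ* and f ∈ 𝓑_γ, ν(|P(t)ⁿ f|) ≤ ν(|f|); (ii) there exist J ≥ 0 and an open interval I_γ containing 0 such that for all t ∈ I_γ and all f ∈ 𝓑_γ, N_{1,γ}(P(t)^{n₀} f) ≤ (κ₀′)^{n₀} N_{1,γ}(f) + J ν(|f|), where κ₀ = ϑ₀^{1/n₀} < κ₀′ < 1; (iii) there is a continuous function φ : ℝ → [0,∞) with φ(0) = 0 such that for all t and all f ∈ 𝓑_γ, ν(|P(t)f − Pf|) ≤ φ(t) N_{1,γ}(f). -/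

import Mathlib

open MeasureTheory ProbabilityTheory Filter Topology
open scoped ENNReal NNReal

noncomputable section

/-- `p_λ(x) = 1 + λ d(x,x₀)` -/
def pfun {M : Type*} [MetricSpace M] (x₀ : M) (lam : ℝ) (x : M) : ℝ :=
  1 + lam * dist x x₀

/-- `δ_λ(g) = max{c(g),1} + λ d(g x₀, x₀)` -/
def deltaFun {M G : Type*} [MetricSpace M] (x₀ : M) (act : G → M → M) (c : G → ℝ)
    (lam : ℝ) (g : G) : ℝ :=
  max (c g) 1 + lam * dist (act g x₀) x₀

/-- `δ̃(g) = 1 + c(g) + d(g x₀, x₀)` -/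
def deltaTilde {M G : Type*} [MetricSpace M] (x₀ : M) (act : G → M → M) (c : G → ℝ)
    (g : G) : ℝ :=
  1 + c g + dist (act g x₀) x₀

/-- the weight `Δ_γ(x,y) = d(x,y) p(x)^γ p(y)^γ` -/
def wDelta {M : Type*} [MetricSpace M] (x₀ : M) (lam γ : ℝ) (x y : M) : ℝ :=
  dist x y * pfun x₀ lam x ^ γ * pfun x₀ lam y ^ γ

/-- `m_γ(f)`, the best Lipschitz-type constant of `f` w.r.t. the weight `Δ_γ` -/
def mGam {M : Type*} [MetricSpace M] (x₀ : M) (lam γ : ℝ) (f : M → ℂ) : ℝ :=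
  sSup {ρ : ℝ | ∃ x y : M, x ≠ y ∧ ρ = ‖f x - f y‖ / wDelta x₀ lam γ x y}

/-- `|f|_η = sup_x |f(x)|/p(x)^{η+1}` -/
def nrmGam {M : Type*} [MetricSpace M] (x₀ : M) (lam η : ℝ) (f : M → ℂ) : ℝ :=
  sSup {ρ : ℝ | ∃ x : M, ρ = ‖f x‖ / pfun x₀ lam x ^ (η + 1)}

/-- membership in the space `𝓑_γ` -/
def memB {M : Type*} [MetricSpace M] (x₀ : M) (lam γ : ℝ) (f : M → ℂ) : Prop :=
  ∃ K : ℝ, ∀ x y : M, ‖f x - f y‖ ≤ K * wDelta x₀ lam γ x y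

/-- the norm `N_{∞,γ}` on `𝓑_γ` -/
def nInf {M : Type*} [MetricSpace M] (x₀ : M) (lam γ : ℝ) (f : M → ℂ) : ℝ :=
  mGam x₀ lam γ f + nrmGam x₀ lam γ f

/-- the Markov transition operator `P` acting on complex functions -/
def Pop {M G : Type*} [MeasurableSpace G] (π : Measure G) (act : G → M → M)
    (f : M → ℂ) (x : M) : ℂ :=
  ∫ g, f (act g x) ∂π

/-- the Markov transition operator `P` acting on real functions -/
def PopR {M G : Type*} [MeasurableSpace G] (π : Measure G) (act : G → M → M)
    (f : M → ℝ) (x : M) : ℝ :=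
  ∫ g, f (act g x) ∂π

/-- the Fourier kernel `P(t)` -/
def Pt {M G : Type*} [MeasurableSpace G] (π : Measure G) (act : G → M → M)
    (ξ : G → M → ℝ) (t : ℝ) (f : M → ℂ) (x : M) : ℂ :=
  ∫ g, Complex.exp (Complex.I * (t * ξ g x)) * f (act g x) ∂π

/-- the derivative kernels `L_k` -/
def Lk {M G : Type*} [MeasurableSpace G] (π : Measure G) (act : G → M → M)
    (ξ : G → M → ℝ) (k : ℕ) (f : M → ℂ) (x : M) : ℂ :=
  ∫ g, (Complex.I * (ξ g x : ℂ)) ^ k * f (act g x) ∂π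

/-- `piStar π n` is the convolution power `π^{*(n+1)}`, the law of `R_{n+1} = Y_{n+1} ⋯ Y₁`. -/
def piStar {G : Type*} [MeasurableSpace G] [Mul G] (π : Measure G) : ℕ → Measure G
  | 0 => π
  | n + 1 => Measure.map (fun q : G × G => q.1 * q.2) (π.prod (piStar π n))

/-- `ϑ₀ = ∫ c(g) δ_{λ₀}(g)^{2γ₀} dπ^{*n₀}(g)` (with `n₀` shifted by one). -/
def theta0 {M G : Type*} [MetricSpace M] [MeasurableSpace G] [Mul G] (x₀ : M)
    (act : G → M → M) (c : G → ℝ) (π : Measure G) (lam₀ γ₀ : ℝ) (n₀ : ℕ) : ℝ :=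
  ∫ g, c g * deltaFun x₀ act c lam₀ g ^ (2 * γ₀) ∂(piStar π n₀)

/-- `𝓙^τ(U,V)` as a lower integral. -/
def Jtau {M G : Type*} [MetricSpace M] [MeasurableSpace G] (x₀ : M) (act : G → M → M)
    (c : G → ℝ) (π : Measure G) (τ : ℝ) (U V : G → ℝ) : ℝ≥0∞ :=
  (∫⁻ g, ENNReal.ofReal (U g * (c g * deltaTilde x₀ act c g ^ (2 * τ))) ∂π) +
    ∫⁻ g, ENNReal.ofReal (V g * deltaTilde x₀ act c g ^ (τ + 1)) ∂π

/-- the random trajectory `Z_n`: `traj act Y Z n = R_n Z` where `R_n = Y_n ⋯ Y₁`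
(`Y k` stands for `Y_{k+1}`). -/
def traj {M G Ω : Type*} (act : G → M → M) (Y : ℕ → Ω → G) (Z : Ω → M) : ℕ → Ω → M
  | 0 => Z
  | n + 1 => fun ω => act (Y n ω) (traj act Y Z n ω)

/-- `S_n^Z = Σ_{k=1}^n ξ(Y_k, Z_{k-1})` -/
def Sn {M G Ω : Type*} (act : G → M → M) (ξ : G → M → ℝ) (Y : ℕ → Ω → G) (Z : Ω → M)
    (n : ℕ) (ω : Ω) : ℝ :=
  ∑ k ∈ Finset.range n, ξ (Y k ω) (traj act Y Z k ω)

/-- convergence in distribution, expressed through bounded continuous test functions -/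
def CvgInDist {Ω : Type*} [MeasurableSpace Ω] (P : Measure Ω) (X : ℕ → Ω → ℝ)
    (μ : Measure ℝ) : Prop :=
  ∀ f : ℝ → ℝ, Continuous f → (∃ C : ℝ, ∀ x, |f x| ≤ C) →
    Tendsto (fun n => ∫ ω, f (X n ω) ∂P) atTop (𝓝 (∫ x, f x ∂μ))

/-- the topological support of a measure -/
def msupport {M : Type*} [TopologicalSpace M] [MeasurableSpace M] (ν : Measure M) : Set M :=
  {x | ∀ U : Set M, IsOpen U → x ∈ U → 0 < ν U}

/-- the product `h* = h₁ ⋯ h_{k+1}` of a tuple of elements of the semigroup `G` -/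
def hstar {G : Type*} [Semigroup G] : ∀ {k : ℕ}, (Fin (k + 1) → G) → G
  | 0, h => h 0
  | _ + 1, h => h 0 * hstar (Fin.tail h)


section Weights

variable {M G : Type*} [MetricSpace M] {x₀ : M} {act : G → M → M} {c : G → ℝ} {lam : ℝ}

theorem one_le_pfun (hlam : 0 ≤ lam) (x : M) : 1 ≤ pfun x₀ lam x := by
  unfold pfun
  have := mul_nonneg hlam (dist_nonneg (x := x) (y := x₀))
  linarith

theorem pfun_pos (hlam : 0 ≤ lam) (x : M) : 0 < pfun x₀ lam x :=
  zero_lt_one.trans_le (one_le_pfun hlam x)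

theorem one_le_deltaFun (hlam : 0 ≤ lam) (g : G) : 1 ≤ deltaFun x₀ act c lam g := by
  unfold deltaFun
  have := mul_nonneg hlam (dist_nonneg (x := act g x₀) (y := x₀))
  linarith [le_max_right (c g) 1]

theorem deltaFun_pos (hlam : 0 ≤ lam) (g : G) : 0 < deltaFun x₀ act c lam g :=
  zero_lt_one.trans_le (one_le_deltaFun hlam g)

theorem deltaFun_le_deltaTilde (hlam' : lam ≤ 1) {g : G} (hc : 0 ≤ c g) :
    deltaFun x₀ act c lam g ≤ deltaTilde x₀ act c g := by
  unfold deltaFun deltaTilde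
  have h1 : max (c g) 1 ≤ 1 + c g := max_le (by linarith) (by linarith)
  have h2 := mul_le_mul_of_nonneg_right hlam' (dist_nonneg (x := act g x₀) (y := x₀))
  linarith

theorem pfun_act_le_add (hlam : 0 ≤ lam)
    (hcLip : ∀ (g : G) (x y : M), dist (act g x) (act g y) ≤ c g * dist x y)
    (g : G) (hc : 0 ≤ c g) (x : M) :
    pfun x₀ lam (act g x) ≤ deltaFun x₀ act c lam g + c g * pfun x₀ lam x := by
  unfold pfun deltaFun
  have h1 := mul_le_mul_of_nonneg_left
    ((dist_triangle (act g x) (act g x₀) x₀).trans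
      (add_le_add_left (hcLip g x x₀) _)) hlam
  linarith [le_max_right (c g) 1]

theorem pfun_act_le (hlam : 0 ≤ lam)
    (hcLip : ∀ (g : G) (x y : M), dist (act g x) (act g y) ≤ c g * dist x y)
    (g : G) (x : M) :
    pfun x₀ lam (act g x) ≤ deltaFun x₀ act c lam g * pfun x₀ lam x := by
  unfold pfun deltaFun
  have h1 := mul_le_mul_of_nonneg_left
    ((dist_triangle (act g x) (act g x₀) x₀).trans
      (add_le_add_left (hcLip g x x₀) _)) hlam
  have h2 : c g * (lam * dist x x₀) ≤ max (c g) 1 * (lam * dist x x₀) :=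
    mul_le_mul_of_nonneg_right (le_max_left _ _) (by positivity)
  have h3 : 0 ≤ lam * dist (act g x₀) x₀ * (lam * dist x x₀) := by positivity
  nlinarith [le_max_right (c g) 1]

theorem deltaFun_mul_le [Semigroup G] (hlam : 0 ≤ lam)
    (hact : ∀ (g h : G) (x : M), act (g * h) x = act g (act h x))
    (hc0 : ∀ g : G, 0 ≤ c g)
    (hcLip : ∀ (g : G) (x y : M), dist (act g x) (act g y) ≤ c g * dist x y)
    (hcMin : ∀ (g : G) (K : ℝ), 0 ≤ K →
      (∀ x y : M, dist (act g x) (act g y) ≤ K * dist x y) → c g ≤ K) (g h : G) :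
    deltaFun x₀ act c lam (g * h) ≤ deltaFun x₀ act c lam g * deltaFun x₀ act c lam h := by
  have hcc : c (g * h) ≤ c g * c h := by
    refine hcMin _ _ (mul_nonneg (hc0 g) (hc0 h)) fun x y => ?_
    rw [hact, hact, mul_assoc]
    exact (hcLip g _ _).trans (mul_le_mul_of_nonneg_left (hcLip h x y) (hc0 g))
  have hm : max (c (g * h)) 1 ≤ max (c g) 1 * max (c h) 1 := by
    refine max_le (hcc.trans ?_) ?_
    · exact mul_le_mul (le_max_left _ _) (le_max_left _ _) (hc0 h) (by positivity)
    · exact one_le_mul_of_one_le_of_one_le (le_max_right _ _) (le_max_right _ _)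
  have hd : dist (act (g * h) x₀) x₀ ≤ max (c g) 1 * dist (act h x₀) x₀ + dist (act g x₀) x₀ := by
    rw [hact]
    refine (dist_triangle _ (act g x₀) _).trans (add_le_add_left ((hcLip g _ _).trans ?_) _)
    exact mul_le_mul_of_nonneg_right (le_max_left _ _) dist_nonneg
  unfold deltaFun
  have h1 := mul_le_mul_of_nonneg_left hd hlam
  have h2 : 0 ≤ lam * dist (act g x₀) x₀ := by positivity
  have h3 : 0 ≤ lam * dist (act g x₀) x₀ * (lam * dist (act h x₀) x₀) := by positivity
  nlinarith [le_max_right (c h) 1]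

theorem wDelta_nonneg (hlam : 0 ≤ lam) (γ : ℝ) (x y : M) : 0 ≤ wDelta x₀ lam γ x y := by
  have := (pfun_pos (x₀ := x₀) hlam x).le
  have := (pfun_pos (x₀ := x₀) hlam y).le
  unfold wDelta
  positivity

theorem wDelta_pos (hlam : 0 ≤ lam) (γ : ℝ) {x y : M} (h : x ≠ y) :
    0 < wDelta x₀ lam γ x y := by
  have := pfun_pos (x₀ := x₀) hlam x
  have := pfun_pos (x₀ := x₀) hlam y
  have := dist_pos.2 h
  unfold wDelta
  positivity

theorem wDelta_act_le (hlam : 0 ≤ lam) (hc0 : ∀ g : G, 0 ≤ c g)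
    (hcLip : ∀ (g : G) (x y : M), dist (act g x) (act g y) ≤ c g * dist x y)
    {γ γ' : ℝ} (hγ : 0 ≤ γ) (hγ' : γ ≤ γ') (g : G) (x y : M) :
    wDelta x₀ lam γ (act g x) (act g y)
      ≤ c g * deltaFun x₀ act c lam g ^ (2 * γ') * wDelta x₀ lam γ x y := by
  have hδ := deltaFun_pos (x₀ := x₀) (act := act) (c := c) hlam g
  have hp (z : M) : pfun x₀ lam (act g z) ^ γ
      ≤ deltaFun x₀ act c lam g ^ γ' * pfun x₀ lam z ^ γ := by
    refine (Real.rpow_le_rpow (pfun_pos hlam _).le (pfun_act_le hlam hcLip g z) hγ).trans ?_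
    rw [Real.mul_rpow hδ.le (pfun_pos hlam z).le]
    have := (pfun_pos (x₀ := x₀) hlam z).le
    gcongr
    exact one_le_deltaFun hlam g
  have hp0 (z : M) : 0 ≤ pfun x₀ lam z ^ γ := Real.rpow_nonneg (pfun_pos hlam z).le _
  have h0 : 0 ≤ deltaFun x₀ act c lam g ^ γ' := Real.rpow_nonneg hδ.le _
  calc wDelta x₀ lam γ (act g x) (act g y)
      ≤ c g * dist x y * (deltaFun x₀ act c lam g ^ γ' * pfun x₀ lam x ^ γ)
          * (deltaFun x₀ act c lam g ^ γ' * pfun x₀ lam y ^ γ) := by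
        unfold wDelta
        have := hc0 g
        exact mul_le_mul (mul_le_mul (hcLip g x y) (hp x) (hp0 _) (by positivity)) (hp y) (hp0 _)
          (mul_nonneg (by positivity) (mul_nonneg h0 (hp0 x)))
    _ = _ := by
        rw [two_mul, Real.rpow_add hδ]
        unfold wDelta
        ring

theorem wDelta_le (hlam : 0 < lam) (γ : ℝ) (x y : M) :
    wDelta x₀ lam γ x y ≤ lam⁻¹ * pfun x₀ lam x ^ (γ + 1) * pfun x₀ lam y ^ (γ + 1) := by
  have hx := pfun_pos (x₀ := x₀) hlam.le x
  have hy := pfun_pos (x₀ := x₀) hlam.le y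
  have hd : dist x y ≤ lam⁻¹ * (pfun x₀ lam x * pfun x₀ lam y) := by
    rw [← div_eq_inv_mul, le_div_iff₀ hlam]
    have h1 := mul_le_mul_of_nonneg_left (dist_triangle_right x y x₀) hlam.le
    have h2 : 0 ≤ lam * dist x x₀ * (lam * dist y x₀) := by positivity
    unfold pfun
    nlinarith
  calc wDelta x₀ lam γ x y
      ≤ lam⁻¹ * (pfun x₀ lam x * pfun x₀ lam y) * pfun x₀ lam x ^ γ * pfun x₀ lam y ^ γ := by
        unfold wDelta
        gcongr
    _ = _ := by
        rw [Real.rpow_add_one hx.ne', Real.rpow_add_one hy.ne']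
        ring

theorem dist_mul_rpow_mul_min_rpow_le (hlam : 0 < lam) (hlam' : lam ≤ 1) {s γ : ℝ} (hs : 0 ≤ s)
    (hsγ : s + 1 ≤ γ) (x y : M) :
    dist x y * (1 + dist x x₀ + dist y x₀) ^ s * min (pfun x₀ lam x) (pfun x₀ lam y) ^ (γ + 1)
      ≤ (2 / lam) ^ s * wDelta x₀ lam γ x y := by
  have hreal {u v w : ℝ} (hu : 1 ≤ u) (huv : u ≤ v) (hw0 : 0 ≤ w) (hw : w ≤ 2 / lam * v) :
      w ^ s * u ^ (γ + 1) ≤ (2 / lam) ^ s * (v ^ γ * u ^ γ) := by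
    have hu0 : 0 < u := by linarith
    have hv0 : 0 < v := by linarith
    calc w ^ s * u ^ (γ + 1) ≤ (2 / lam * v) ^ s * (u ^ γ * v) := by
          rw [Real.rpow_add_one hu0.ne']
          gcongr
      _ = (2 / lam) ^ s * (v ^ (s + 1) * u ^ γ) := by
          rw [Real.mul_rpow (by positivity) hv0.le, Real.rpow_add_one hv0.ne']
          ring
      _ ≤ _ := by
          gcongr
          linarith
  have hx := one_le_pfun (x₀ := x₀) hlam.le x
  have hy := one_le_pfun (x₀ := x₀) hlam.le y
  have hdx : dist x x₀ = (pfun x₀ lam x - 1) / lam := by unfold pfun; field_simp; ring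
  have hdy : dist y x₀ = (pfun x₀ lam y - 1) / lam := by unfold pfun; field_simp; ring
  have hw : 1 + dist x x₀ + dist y x₀ ≤ (pfun x₀ lam x + pfun x₀ lam y) / lam := by
    rw [hdx, hdy, le_div_iff₀ hlam]
    field_simp
    linarith
  have hw0 : 0 ≤ 1 + dist x x₀ + dist y x₀ := by positivity
  have he : (2 / lam) ^ s * wDelta x₀ lam γ x y
      = dist x y * ((2 / lam) ^ s * (pfun x₀ lam x ^ γ * pfun x₀ lam y ^ γ)) := by
    unfold wDelta
    ring
  rw [he, mul_assoc]
  refine mul_le_mul_of_nonneg_left ?_ (dist_nonneg (x := x) (y := y))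
  rcases le_total (pfun x₀ lam x) (pfun x₀ lam y) with h | h
  · rw [min_eq_left h, mul_comm (pfun x₀ lam x ^ γ)]
    refine hreal hx h hw0 (hw.trans ?_)
    rw [div_mul_eq_mul_div]
    gcongr
    linarith
  · rw [min_eq_right h]
    refine hreal hy h hw0 (hw.trans ?_)
    rw [div_mul_eq_mul_div]
    gcongr
    linarith

theorem continuous_pfun : Continuous (pfun x₀ lam) := by
  unfold pfun
  fun_prop

theorem continuous_pfun_rpow (hlam : 0 ≤ lam) (γ : ℝ) :
    Continuous fun x => pfun x₀ lam x ^ γ :=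
  continuous_pfun.rpow_const fun x => Or.inl (pfun_pos hlam x).ne'

theorem measurable_deltaFun [MeasurableSpace M] [BorelSpace M] [MeasurableSpace G]
    (hactm : Measurable fun q : G × M => act q.1 q.2) (hcm : Measurable c) :
    Measurable (deltaFun x₀ act c lam) := by
  have h1 : Measurable fun g => act g x₀ := hactm.comp (measurable_id.prodMk measurable_const)
  have h2 : Measurable fun g => dist (act g x₀) x₀ :=
    (show Continuous fun x : M => dist x x₀ by fun_prop).measurable.comp h1
  exact (hcm.max measurable_const).add (h2.const_mul lam)

end Weights

section Functions

variable {M : Type*} [MetricSpace M] {x₀ : M} {lam γ : ℝ} {f : M → ℂ}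

theorem mGam_nonneg (hlam : 0 ≤ lam) : 0 ≤ mGam x₀ lam γ f := by
  refine Real.sSup_nonneg ?_
  rintro _ ⟨x, y, -, rfl⟩
  exact div_nonneg (norm_nonneg _) (wDelta_nonneg hlam γ x y)

theorem mGam_le (hlam : 0 ≤ lam) {K : ℝ} (hK : 0 ≤ K)
    (h : ∀ x y, ‖f x - f y‖ ≤ K * wDelta x₀ lam γ x y) : mGam x₀ lam γ f ≤ K := by
  refine Real.sSup_le ?_ hK
  rintro _ ⟨x, y, hxy, rfl⟩
  exact (div_le_iff₀ (wDelta_pos hlam γ hxy)).2 (h x y)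

theorem memB.norm_sub_le (hlam : 0 ≤ lam) (hf : memB x₀ lam γ f) (x y : M) :
    ‖f x - f y‖ ≤ mGam x₀ lam γ f * wDelta x₀ lam γ x y := by
  rcases eq_or_ne x y with rfl | hxy
  · simp [wDelta]
  obtain ⟨K, hK⟩ := hf
  rw [← div_le_iff₀ (wDelta_pos hlam γ hxy)]
  refine le_csSup ⟨K, ?_⟩ ⟨x, y, hxy, rfl⟩
  rintro _ ⟨x, y, hxy, rfl⟩
  exact (div_le_iff₀ (wDelta_pos hlam γ hxy)).2 (hK x y)

theorem memB.continuous (hlam : 0 ≤ lam) (hf : memB x₀ lam γ f) : Continuous f := by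
  obtain ⟨K, hK⟩ := hf
  refine continuous_iff_continuousAt.2 fun x => ?_
  refine tendsto_iff_norm_sub_tendsto_zero.2 (squeeze_zero (fun _ => norm_nonneg _)
    (fun y => hK y x) ?_)
  have h : Continuous fun y => K * wDelta x₀ lam γ y x := by
    unfold wDelta
    exact (((continuous_id.dist continuous_const).mul (continuous_pfun_rpow hlam γ)).mul
      continuous_const).const_mul K
  simpa [wDelta] using h.tendsto x

theorem memB.norm_le (hlam : 0 < lam) (hf : memB x₀ lam γ f) (x y : M) :
    ‖f x‖ ≤ ‖f y‖ + mGam x₀ lam γ f / lam * pfun x₀ lam x ^ (γ + 1) * pfun x₀ lam y ^ (γ + 1) := by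
  have h1 := (hf.norm_sub_le hlam.le x y).trans
    (mul_le_mul_of_nonneg_left (wDelta_le hlam γ x y) (mGam_nonneg hlam.le))
  have h2 := norm_sub_norm_le (f x) (f y)
  have h3 : mGam x₀ lam γ f * (lam⁻¹ * pfun x₀ lam x ^ (γ + 1) * pfun x₀ lam y ^ (γ + 1))
      = mGam x₀ lam γ f / lam * pfun x₀ lam x ^ (γ + 1) * pfun x₀ lam y ^ (γ + 1) := by
    ring
  linarith

variable [MeasurableSpace M] [BorelSpace M] {ν : Measure M}
  [IsProbabilityMeasure ν]

theorem memB.integrable (hlam : 0 < lam) (hν : Integrable (fun x => pfun x₀ lam x ^ (γ + 1)) ν)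
    (hf : memB x₀ lam γ f) : Integrable f ν := by
  refine Integrable.mono' ((integrable_const ‖f x₀‖).add
    ((hν.const_mul (mGam x₀ lam γ f / lam)).mul_const (pfun x₀ lam x₀ ^ (γ + 1))))
    (hf.continuous hlam.le).measurable.aestronglyMeasurable (ae_of_all _ fun x => ?_)
  exact hf.norm_le hlam x x₀

theorem memB.norm_le_mul_rpow (hlam : 0 < lam) (hγ : 0 ≤ γ)
    (hν : Integrable (fun x => pfun x₀ lam x ^ (γ + 1)) ν) (hf : memB x₀ lam γ f) (x : M) :
    ‖f x‖ ≤ (1 + (∫ y, pfun x₀ lam y ^ (γ + 1) ∂ν) / lam)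
      * (mGam x₀ lam γ f + ∫ y, ‖f y‖ ∂ν) * pfun x₀ lam x ^ (γ + 1) := by
  have hfint := (hf.integrable hlam hν).norm
  have hi := integral_mono (integrable_const ‖f x‖) (hfint.add
    (hν.const_mul (mGam x₀ lam γ f / lam * pfun x₀ lam x ^ (γ + 1)))) (μ := ν)
    fun y => hf.norm_le hlam x y
  simp only [Pi.add_apply] at hi
  rw [integral_add hfint (hν.const_mul _), integral_const_mul] at hi
  simp only [integral_const, probReal_univ, one_smul] at hi
  have hp : 1 ≤ pfun x₀ lam x ^ (γ + 1) :=
    Real.one_le_rpow (one_le_pfun hlam.le x) (by linarith)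
  have hI : 0 ≤ ∫ y, pfun x₀ lam y ^ (γ + 1) ∂ν :=
    integral_nonneg fun y => Real.rpow_nonneg (pfun_pos hlam.le y).le _
  have hm : 0 ≤ mGam x₀ lam γ f := mGam_nonneg hlam.le
  have hF : 0 ≤ ∫ y, ‖f y‖ ∂ν := integral_nonneg fun y => norm_nonneg _
  have hIl : 0 ≤ (∫ y, pfun x₀ lam y ^ (γ + 1) ∂ν) / lam := by positivity
  refine hi.trans ?_
  generalize pfun x₀ lam x ^ (γ + 1) = p at *
  have e : mGam x₀ lam γ f / lam * p * ∫ y, pfun x₀ lam y ^ (γ + 1) ∂ν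
      = (∫ y, pfun x₀ lam y ^ (γ + 1) ∂ν) / lam * mGam x₀ lam γ f * p := by ring
  rw [e]
  generalize (∫ y, pfun x₀ lam y ^ (γ + 1) ∂ν) / lam = I at *
  generalize (∫ y, ‖f y‖ ∂ν) = F at *
  generalize mGam x₀ lam γ f = m at *
  have h1 : F ≤ F * p := le_mul_of_one_le_right hF hp
  have h2 : 0 ≤ m * p := by positivity
  have h3 : 0 ≤ I * F * p := by positivity
  linarith

end Functions

section Convolution

variable {G : Type*} [Semigroup G] [MeasurableSpace G] [MeasurableMul₂ G]
  {π : Measure G} [IsProbabilityMeasure π]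

instance isProbabilityMeasure_piStar (n : ℕ) : IsProbabilityMeasure (piStar π n) := by
  induction n with
  | zero => exact ‹IsProbabilityMeasure π›
  | succ n ih => exact Measure.isProbabilityMeasure_map measurable_mul.aemeasurable

theorem lintegral_piStar_succ (n : ℕ) {F : G → ℝ≥0∞} (hF : Measurable F) :
    ∫⁻ g, F g ∂(piStar π (n + 1)) = ∫⁻ h, ∫⁻ g, F (g * h) ∂π ∂(piStar π n) := by
  have hm : Measurable fun q : G × G => F (q.1 * q.2) := hF.comp measurable_mul
  rw [piStar, lintegral_map hF measurable_mul, lintegral_prod_symm' _ hm]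

theorem lintegral_piStar_lt_top {F : G → ℝ≥0∞} (hF : Measurable F)
    (hmul : ∀ g h, F (g * h) ≤ F g * F h) (hfin : ∫⁻ g, F g ∂π < ⊤) (n : ℕ) :
    ∫⁻ g, F g ∂(piStar π n) < ⊤ := by
  induction n with
  | zero => exact hfin
  | succ n ih =>
    rw [lintegral_piStar_succ n hF]
    calc ∫⁻ h, ∫⁻ g, F (g * h) ∂π ∂(piStar π n)
        ≤ ∫⁻ h, (∫⁻ g, F g ∂π) * F h ∂(piStar π n) := by
          refine lintegral_mono fun h => ?_
          rw [← lintegral_mul_const _ hF]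
          exact lintegral_mono fun g => hmul g h
      _ < ⊤ := by
          rw [lintegral_const_mul _ hF]
          exact ENNReal.mul_lt_top hfin ih

variable {M : Type*} [MeasurableSpace M] {act : G → M → M} {ν : Measure M} [IsProbabilityMeasure ν]

theorem lintegral_act_piStar (hact : ∀ (g h : G) (x : M), act (g * h) x = act g (act h x))
    (hactm : Measurable fun q : G × M => act q.1 q.2)
    (hν : Measure.map (fun q : G × M => act q.1 q.2) (π.prod ν) = ν) (n : ℕ) :
    ∀ {F : M → ℝ≥0∞}, Measurable F →
      ∫⁻ x, ∫⁻ g, F (act g x) ∂(piStar π n) ∂ν = ∫⁻ x, F x ∂ν := by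
  have h0 {F : M → ℝ≥0∞} (hF : Measurable F) :
      ∫⁻ x, ∫⁻ g, F (act g x) ∂π ∂ν = ∫⁻ x, F x ∂ν := by
    conv_rhs => rw [← hν]
    rw [lintegral_map hF hactm]
    exact (lintegral_prod_symm' (fun q : G × M => F (act q.1 q.2)) (hF.comp hactm)).symm
  induction n with
  | zero => exact h0
  | succ n ih =>
    intro F hF
    have hQ : Measurable fun x => ∫⁻ g, F (act g x) ∂π :=
      Measurable.lintegral_prod_left' (f := fun q : G × M => F (act q.1 q.2)) (hF.comp hactm)
    have h1 (x : M) : ∫⁻ g, F (act g x) ∂(piStar π (n + 1))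
        = ∫⁻ h, ∫⁻ g, F (act g (act h x)) ∂π ∂(piStar π n) := by
      have hm : Measurable fun g => F (act g x) :=
        hF.comp (hactm.comp (measurable_id.prodMk measurable_const))
      rw [lintegral_piStar_succ n hm]
      simp only [hact]
    simp only [h1]
    rw [ih hQ, h0 hF]

end Convolution

/-- Drift criterion: a probability measure that is invariant under a Markov kernel (given as an
average over maps) integrates every function `V` with `T V ≤ κ V + C`, `κ < 1`. -/
theorem lintegral_lt_top_of_drift {M G : Type*} [MeasurableSpace M] [MeasurableSpace G]
    {act : G → M → M} {ρ : Measure G} [IsProbabilityMeasure ρ]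
    {ν : Measure M} [IsProbabilityMeasure ν]
    (hinv : ∀ {F : M → ℝ≥0∞}, Measurable F →
      ∫⁻ x, ∫⁻ g, F (act g x) ∂ρ ∂ν = ∫⁻ x, F x ∂ν)
    (hactm : Measurable fun q : G × M => act q.1 q.2)
    {V : M → ℝ≥0∞} (hV : Measurable V) (hVtop : ∀ x, V x ≠ ⊤)
    {κ C : ℝ≥0∞} (hκ : κ < 1) (hC : C ≠ ⊤)
    (hdrift : ∀ x, ∫⁻ g, V (act g x) ∂ρ ≤ κ * V x + C) :
    ∫⁻ x, V x ∂ν < ⊤ := by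
  have hiter (k : ℝ≥0∞) (n : ℕ) : ∫⁻ x, min (V x) k ∂ν
      ≤ ∫⁻ x, min (κ ^ n * V x + C * ∑ i ∈ Finset.range n, κ ^ i) k ∂ν := by
    induction n with
    | zero => simp
    | succ n ih =>
      refine ih.trans ?_
      have hm : Measurable fun x => min (κ ^ n * V x + C * ∑ i ∈ Finset.range n, κ ^ i) k :=
        ((hV.const_mul _).add_const _).min measurable_const
      rw [← hinv hm]
      refine lintegral_mono fun x => le_min ?_ ?_
      · have hmx : Measurable fun g => V (act g x) :=
          hV.comp (hactm.comp (measurable_id.prodMk measurable_const))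
        calc ∫⁻ g, min (κ ^ n * V (act g x) + C * ∑ i ∈ Finset.range n, κ ^ i) k ∂ρ
            ≤ ∫⁻ g, (κ ^ n * V (act g x) + C * ∑ i ∈ Finset.range n, κ ^ i) ∂ρ :=
              lintegral_mono fun g => min_le_left _ _
          _ = κ ^ n * ∫⁻ g, V (act g x) ∂ρ + C * ∑ i ∈ Finset.range n, κ ^ i := by
              rw [lintegral_add_right _ measurable_const, lintegral_const_mul _ hmx]
              simp
          _ ≤ κ ^ n * (κ * V x + C) + C * ∑ i ∈ Finset.range n, κ ^ i := by
              gcongr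
              exact hdrift x
          _ = κ ^ (n + 1) * V x + C * ∑ i ∈ Finset.range (n + 1), κ ^ i := by
              rw [Finset.sum_range_succ]
              ring
      · refine (lintegral_mono fun g => min_le_right _ k).trans ?_
        simp
  have hgeom (n : ℕ) : C * ∑ i ∈ Finset.range n, κ ^ i ≤ C * (1 - κ)⁻¹ := by
    rw [← ENNReal.tsum_geometric]
    gcongr
    exact ENNReal.sum_le_tsum _
  have hC' : C * (1 - κ)⁻¹ < ⊤ :=
    ENNReal.mul_lt_top hC.lt_top (ENNReal.inv_lt_top.2 (tsub_pos_of_lt hκ))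
  have hbdd (k : ℕ) : ∫⁻ x, min (V x) k ∂ν ≤ C * (1 - κ)⁻¹ := by
    have hlim : Tendsto (fun n : ℕ => ∫⁻ x, min (κ ^ n * V x) k ∂ν) atTop
        (𝓝 (∫⁻ _, 0 ∂ν)) := by
      refine tendsto_lintegral_of_dominated_convergence (fun _ => (k : ℝ≥0∞))
        (fun n => (hV.const_mul _).min measurable_const)
        (fun n => ae_of_all _ fun x => min_le_right _ _) (by simp) (ae_of_all _ fun x => ?_)
      have h1 : Tendsto (fun n : ℕ => κ ^ n * V x) atTop (𝓝 (0 * V x)) :=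
        ENNReal.Tendsto.mul_const (ENNReal.tendsto_pow_atTop_nhds_zero_of_lt_one hκ)
          (Or.inr (hVtop x))
      have h2 := h1.min (tendsto_const_nhds (x := (k : ℝ≥0∞)))
      simpa using h2
    have hlim' := hlim.add (tendsto_const_nhds (x := C * (1 - κ)⁻¹))
    rw [lintegral_zero, zero_add] at hlim'
    refine ge_of_tendsto' hlim' fun n => (hiter k n).trans ?_
    calc ∫⁻ x, min (κ ^ n * V x + C * ∑ i ∈ Finset.range n, κ ^ i) k ∂ν
        ≤ ∫⁻ x, (min (κ ^ n * V x) k + C * (1 - κ)⁻¹) ∂ν := by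
          refine lintegral_mono fun x => ?_
          rcases le_total (κ ^ n * V x) k with h | h
          · rw [min_eq_left h]
            exact (min_le_left _ _).trans (add_le_add_right (hgeom n) _)
          · rw [min_eq_right h]
            exact (min_le_right _ _).trans le_self_add
      _ = _ := by
          rw [lintegral_add_right _ measurable_const]
          simp
  refine lt_of_le_of_lt ?_ hC'
  have hmono : ∫⁻ x, V x ∂ν = ⨆ k : ℕ, ∫⁻ x, min (V x) k ∂ν := by
    rw [← lintegral_iSup (fun k => hV.min measurable_const)
      (fun i j hij x => min_le_min le_rfl (by exact_mod_cast hij))]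
    refine lintegral_congr fun x => ?_
    refine le_antisymm ?_ (iSup_le fun k => min_le_left _ _)
    obtain ⟨k, hk⟩ := ENNReal.exists_nat_gt (hVtop x)
    exact (le_min le_rfl hk.le).trans (le_iSup (fun k : ℕ => min (V x) (k : ℝ≥0∞)) k)
  rw [hmono]
  exact iSup_le hbdd

theorem add_rpow_le_rpow_add_rpow {a b ε q : ℝ} (ha : 0 ≤ a) (hb : 0 ≤ b) (hε : 0 < ε)
    (hq : 0 ≤ q) : (a + b) ^ q ≤ (1 + ε) ^ q * b ^ q + (1 + ε⁻¹) ^ q * a ^ q := by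
  rcases le_total a (ε * b) with h | h
  · calc (a + b) ^ q ≤ ((1 + ε) * b) ^ q := by
          gcongr
          linarith
      _ = (1 + ε) ^ q * b ^ q := Real.mul_rpow (by positivity) hb
      _ ≤ _ := le_add_of_nonneg_right (by positivity)
  · have h' : b ≤ ε⁻¹ * a := by
      rwa [← div_eq_inv_mul, le_div_iff₀ hε, mul_comm]
    calc (a + b) ^ q ≤ ((1 + ε⁻¹) * a) ^ q := by
          gcongr
          linarith
      _ = (1 + ε⁻¹) ^ q * a ^ q := Real.mul_rpow (by positivity) ha
      _ ≤ _ := le_add_of_nonneg_left (by positivity)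

section InvariantMeasure

variable {M G : Type*} [MetricSpace M] [MeasurableSpace M] [BorelSpace M]
  [MeasurableSpace G] {x₀ : M} {act : G → M → M} {c : G → ℝ} {lam : ℝ}

/-- If the `q`-th moment of the Lipschitz constants is `< 1`, then an invariant probability measure
has a finite moment of order `q`. -/
theorem integrable_pfun_rpow_of_invariant (hlam : 0 ≤ lam)
    (hactm : Measurable fun q : G × M => act q.1 q.2) (hcm : Measurable c)
    (hc0 : ∀ g : G, 0 ≤ c g)
    (hcLip : ∀ (g : G) (x y : M), dist (act g x) (act g y) ≤ c g * dist x y)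
    {ρ : Measure G} [IsProbabilityMeasure ρ] {ν : Measure M} [IsProbabilityMeasure ν]
    (hinv : ∀ {F : M → ℝ≥0∞}, Measurable F →
      ∫⁻ x, ∫⁻ g, F (act g x) ∂ρ ∂ν = ∫⁻ x, F x ∂ν)
    {q : ℝ} (hq : 0 ≤ q)
    (hδ : ∫⁻ g, ENNReal.ofReal (deltaFun x₀ act c lam g ^ q) ∂ρ < ⊤)
    (hc : ∫⁻ g, ENNReal.ofReal (c g ^ q) ∂ρ < 1) :
    Integrable (fun x => pfun x₀ lam x ^ q) ν := by
  have hp0 (x : M) : 0 ≤ pfun x₀ lam x := (pfun_pos hlam x).le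
  have hδ0 (g : G) : 0 ≤ deltaFun x₀ act c lam g := (deltaFun_pos hlam g).le
  have hVm : Measurable fun x => pfun x₀ lam x ^ q := (continuous_pfun_rpow hlam q).measurable
  obtain ⟨ε, hε, hεc⟩ : ∃ ε : ℝ, 0 < ε ∧
      ENNReal.ofReal ((1 + ε) ^ q) * ∫⁻ g, ENNReal.ofReal (c g ^ q) ∂ρ < 1 := by
    have h1 : Tendsto (fun ε : ℝ => (1 + ε) ^ q) (𝓝 0) (𝓝 ((1 + 0) ^ q)) :=
      (tendsto_const_nhds.add tendsto_id).rpow_const (Or.inl (by norm_num))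
    have h2 := ENNReal.Tendsto.mul_const (b := ∫⁻ g, ENNReal.ofReal (c g ^ q) ∂ρ)
      (ENNReal.tendsto_ofReal h1) (Or.inr hc.ne_top)
    rw [add_zero, Real.one_rpow, ENNReal.ofReal_one, one_mul] at h2
    have h3 := (h2.mono_left (nhdsWithin_le_nhds (s := Set.Ioi 0))).eventually (gt_mem_nhds hc)
    obtain ⟨ε, h, hε⟩ := (h3.and self_mem_nhdsWithin).exists
    exact ⟨ε, hε, h⟩
  have key : ∫⁻ x, ENNReal.ofReal (pfun x₀ lam x ^ q) ∂ν < ⊤ := by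
    refine lintegral_lt_top_of_drift hinv hactm hVm.ennreal_ofReal
      (fun x => ENNReal.ofReal_ne_top)
      (κ := ENNReal.ofReal ((1 + ε) ^ q) * ∫⁻ g, ENNReal.ofReal (c g ^ q) ∂ρ)
      (C := ENNReal.ofReal ((1 + ε⁻¹) ^ q) *
        ∫⁻ g, ENNReal.ofReal (deltaFun x₀ act c lam g ^ q) ∂ρ)
      hεc (ENNReal.mul_ne_top ENNReal.ofReal_ne_top hδ.ne) fun x => ?_
    have hcm' : Measurable fun g => ENNReal.ofReal (c g ^ q) := (hcm.pow_const q).ennreal_ofReal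
    have hδm : Measurable fun g => ENNReal.ofReal (deltaFun x₀ act c lam g ^ q) :=
      ((measurable_deltaFun hactm hcm).pow_const q).ennreal_ofReal
    rw [mul_right_comm (ENNReal.ofReal _), ← lintegral_const_mul _ hcm',
      ← lintegral_const_mul _ hδm,
      ← lintegral_add_right _ (hδm.const_mul _)]
    refine lintegral_mono fun g => ?_
    have h1 : 0 ≤ (1 + ε) ^ q := by positivity
    have h2 : 0 ≤ (1 + ε⁻¹) ^ q := by positivity
    have h3 : 0 ≤ pfun x₀ lam x ^ q := Real.rpow_nonneg (hp0 x) _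
    have h4 : 0 ≤ c g ^ q := Real.rpow_nonneg (hc0 g) _
    have h5 : 0 ≤ deltaFun x₀ act c lam g ^ q := Real.rpow_nonneg (hδ0 g) _
    rw [← ENNReal.ofReal_mul h1, ← ENNReal.ofReal_mul (by positivity), ← ENNReal.ofReal_mul h2,
      ← ENNReal.ofReal_add (by positivity) (by positivity)]
    refine ENNReal.ofReal_le_ofReal ?_
    calc pfun x₀ lam (act g x) ^ q
        ≤ (deltaFun x₀ act c lam g + c g * pfun x₀ lam x) ^ q :=
          Real.rpow_le_rpow (hp0 _) (pfun_act_le_add hlam hcLip g (hc0 g) x) hq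
      _ ≤ (1 + ε) ^ q * (c g * pfun x₀ lam x) ^ q
          + (1 + ε⁻¹) ^ q * deltaFun x₀ act c lam g ^ q :=
          add_rpow_le_rpow_add_rpow (hδ0 g) (mul_nonneg (hc0 g) (hp0 x)) hε hq
      _ = _ := by
          rw [Real.mul_rpow (hc0 g) (hp0 x)]
          ring
  exact (lintegral_ofReal_ne_top_iff_integrable hVm.aestronglyMeasurable
    (ae_of_all _ fun x => Real.rpow_nonneg (hp0 x) _)).1 key.ne

end InvariantMeasure

section FourierKernel

theorem norm_exp_mul_sub_exp_mul_le (a b : ℝ) (u v : ℂ) :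
    ‖Complex.exp (Complex.I * a) * u - Complex.exp (Complex.I * b) * v‖
      ≤ ‖u - v‖ + |a - b| * min ‖u‖ ‖v‖ := by
  have hn (r : ℝ) : ‖Complex.exp (Complex.I * r)‖ = 1 := by
    rw [mul_comm, Complex.norm_exp_ofReal_mul_I]
  have hd : ‖Complex.exp (Complex.I * a) - Complex.exp (Complex.I * b)‖ ≤ |a - b| := by
    have h1 : Complex.exp (Complex.I * a) - Complex.exp (Complex.I * b)
        = Complex.exp (Complex.I * b) * (Complex.exp (Complex.I * (a - b : ℝ)) - 1) := by
      rw [mul_sub, ← Complex.exp_add]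
      push_cast
      ring_nf
    rw [h1, norm_mul, hn, one_mul]
    exact Real.norm_exp_I_mul_ofReal_sub_one_le
  rcases le_total ‖u‖ ‖v‖ with h | h
  · rw [min_eq_left h]
    calc ‖Complex.exp (Complex.I * a) * u - Complex.exp (Complex.I * b) * v‖
        = ‖Complex.exp (Complex.I * b) * (u - v)
            + (Complex.exp (Complex.I * a) - Complex.exp (Complex.I * b)) * u‖ := by
          ring_nf
      _ ≤ _ := by
          refine (norm_add_le _ _).trans ?_
          rw [norm_mul, norm_mul, hn, one_mul]
          gcongr
  · rw [min_eq_right h]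
    calc ‖Complex.exp (Complex.I * a) * u - Complex.exp (Complex.I * b) * v‖
        = ‖Complex.exp (Complex.I * a) * (u - v)
            + (Complex.exp (Complex.I * a) - Complex.exp (Complex.I * b)) * v‖ := by
          ring_nf
      _ ≤ _ := by
          refine (norm_add_le _ _).trans ?_
          rw [norm_mul, norm_mul, hn, one_mul]
          gcongr

variable {M G : Type*} [MeasurableSpace G] {act : G → M → M} {π : Measure G} {ξ : G → M → ℝ}

theorem norm_exp_I_mul_mul (t r : ℝ) (z : ℂ) :
    ‖Complex.exp (Complex.I * (t * r)) * z‖ = ‖z‖ := by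
  rw [norm_mul, mul_comm Complex.I, ← Complex.ofReal_mul, Complex.norm_exp_ofReal_mul_I, one_mul]

theorem norm_Pt_le (t : ℝ) (f : M → ℂ) (x : M) :
    ‖Pt π act ξ t f x‖ ≤ ∫ g, ‖f (act g x)‖ ∂π := by
  refine (norm_integral_le_integral_norm _).trans_eq ?_
  simp only [norm_exp_I_mul_mul]

variable [MeasurableSpace M]

theorem measurable_exp_mul_act (hactm : Measurable fun q : G × M => act q.1 q.2)
    (hξm : Measurable fun q : G × M => ξ q.1 q.2) (t : ℝ) {f : M → ℂ} (hf : Measurable f) :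
    Measurable fun q : G × M => Complex.exp (Complex.I * (t * ξ q.1 q.2)) * f (act q.1 q.2) :=
  (Complex.measurable_exp.comp
    (((Complex.measurable_ofReal.comp hξm).const_mul _).const_mul _)).mul (hf.comp hactm)

variable [IsProbabilityMeasure π]

theorem measurable_Pt (hactm : Measurable fun q : G × M => act q.1 q.2)
    (hξm : Measurable fun q : G × M => ξ q.1 q.2) (t : ℝ) {f : M → ℂ} (hf : Measurable f) :
    Measurable (Pt π act ξ t f) :=
  ((measurable_exp_mul_act hactm hξm t hf).stronglyMeasurable.integral_prod_left').measurable

variable {ν : Measure M} [IsProbabilityMeasure ν]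

theorem integrable_Pt_and_integral_norm_le
    (hactm : Measurable fun q : G × M => act q.1 q.2)
    (hν : Measure.map (fun q : G × M => act q.1 q.2) (π.prod ν) = ν)
    (hξm : Measurable fun q : G × M => ξ q.1 q.2) (t : ℝ) {f : M → ℂ} (hf : Measurable f)
    (hfi : Integrable f ν) :
    Integrable (Pt π act ξ t f) ν ∧ ∫ x, ‖Pt π act ξ t f x‖ ∂ν ≤ ∫ x, ‖f x‖ ∂ν := by
  have hprod : Integrable (fun q : G × M => ‖f (act q.1 q.2)‖) (π.prod ν) := by
    have h := hfi.norm
    rw [← hν] at h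
    exact h.comp_measurable hactm
  have hi : Integrable (fun x => ∫ g, ‖f (act g x)‖ ∂π) ν := hprod.integral_prod_right
  have he : ∫ x, ∫ g, ‖f (act g x)‖ ∂π ∂ν = ∫ x, ‖f x‖ ∂ν := by
    conv_rhs => rw [← hν]
    rw [integral_map hactm.aemeasurable hf.norm.aestronglyMeasurable]
    exact (integral_prod_symm _ hprod).symm
  have hPi : Integrable (Pt π act ξ t f) ν :=
    hi.mono' (measurable_Pt hactm hξm t hf).aestronglyMeasurable
      (ae_of_all _ fun x => norm_Pt_le t f x)
  exact ⟨hPi, (integral_mono hPi.norm hi fun x => norm_Pt_le t f x).trans_eq he⟩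

theorem integral_norm_iterate_Pt_le
    (hactm : Measurable fun q : G × M => act q.1 q.2)
    (hν : Measure.map (fun q : G × M => act q.1 q.2) (π.prod ν) = ν)
    (hξm : Measurable fun q : G × M => ξ q.1 q.2) (t : ℝ) (n : ℕ) :
    ∀ {f : M → ℂ}, Measurable f → Integrable f ν →
      ∫ x, ‖(Pt π act ξ t)^[n] f x‖ ∂ν ≤ ∫ x, ‖f x‖ ∂ν := by
  induction n with
  | zero => exact fun _ _ => le_rfl
  | succ n ih =>
    intro f hf hfi
    obtain ⟨h1, h2⟩ := integrable_Pt_and_integral_norm_le hactm hν hξm t hf hfi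
    rw [Function.iterate_succ_apply]
    exact (ih (measurable_Pt hactm hξm t hf) h1).trans h2

end FourierKernel

section Perturbation

variable {M G : Type*} [MetricSpace M] {x₀ : M} {act : G → M → M} {c : G → ℝ} {lam γ : ℝ}

theorem norm_act_le (hlam : 0 ≤ lam)
    (hcLip : ∀ (g : G) (x y : M), dist (act g x) (act g y) ≤ c g * dist x y) (hγ : 0 ≤ γ)
    {f : M → ℂ} {A : ℝ} (hA : 0 ≤ A) (hfA : ∀ x, ‖f x‖ ≤ A * pfun x₀ lam x ^ (γ + 1))
    (g : G) (x : M) :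
    ‖f (act g x)‖ ≤ A * (deltaFun x₀ act c lam g ^ (γ + 1) * pfun x₀ lam x ^ (γ + 1)) := by
  refine (hfA _).trans (mul_le_mul_of_nonneg_left ?_ hA)
  rw [← Real.mul_rpow (deltaFun_pos hlam g).le (pfun_pos hlam x).le]
  exact Real.rpow_le_rpow (pfun_pos hlam _).le (pfun_act_le hlam hcLip g x) (by linarith)

variable [MeasurableSpace G] {π : Measure G} {ξ : G → M → ℝ}

theorem norm_Pt_le_mul_rpow (hlam : 0 ≤ lam)
    (hcLip : ∀ (g : G) (x y : M), dist (act g x) (act g y) ≤ c g * dist x y) (hγ : 0 ≤ γ)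
    (hδ : Integrable (fun g => deltaFun x₀ act c lam g ^ (γ + 1)) π)
    {f : M → ℂ} {A : ℝ} (hA : 0 ≤ A) (hfA : ∀ x, ‖f x‖ ≤ A * pfun x₀ lam x ^ (γ + 1))
    (t : ℝ) (x : M) :
    ‖Pt π act ξ t f x‖
      ≤ A * (∫ g, deltaFun x₀ act c lam g ^ (γ + 1) ∂π) * pfun x₀ lam x ^ (γ + 1) := by
  refine (norm_Pt_le t f x).trans ?_
  calc ∫ g, ‖f (act g x)‖ ∂π
      ≤ ∫ g, A * (deltaFun x₀ act c lam g ^ (γ + 1) * pfun x₀ lam x ^ (γ + 1)) ∂π :=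
        integral_mono_of_nonneg (ae_of_all _ fun _ => norm_nonneg _)
          ((hδ.mul_const _).const_mul _)
          (ae_of_all _ fun g => norm_act_le hlam hcLip hγ hA hfA g x)
    _ = _ := by
        rw [integral_const_mul, integral_mul_const, mul_assoc]

variable [MeasurableSpace M]

theorem integrable_exp_mul_act (hlam : 0 ≤ lam)
    (hactm : Measurable fun q : G × M => act q.1 q.2)
    (hcLip : ∀ (g : G) (x y : M), dist (act g x) (act g y) ≤ c g * dist x y) (hγ : 0 ≤ γ)
    (hξm : Measurable fun q : G × M => ξ q.1 q.2)
    (hδ : Integrable (fun g => deltaFun x₀ act c lam g ^ (γ + 1)) π)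
    {f : M → ℂ} (hf : Measurable f) {A : ℝ} (hA : 0 ≤ A)
    (hfA : ∀ x, ‖f x‖ ≤ A * pfun x₀ lam x ^ (γ + 1)) (t : ℝ) (x : M) :
    Integrable (fun g => Complex.exp (Complex.I * (t * ξ g x)) * f (act g x)) π := by
  refine ((hδ.mul_const (pfun x₀ lam x ^ (γ + 1))).const_mul A).mono' ?_ (ae_of_all _ fun g => ?_)
  · exact ((measurable_exp_mul_act hactm hξm t hf).comp
      (measurable_id.prodMk measurable_const)).aestronglyMeasurable
  · rw [norm_exp_I_mul_mul]
    exact norm_act_le hlam hcLip hγ hA hfA g x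

/-- One application of `P(t)` averages the two-point modulus of continuity, up to an error of order
`|t|` in the weight `Δ_γ`. -/
theorem enorm_Pt_sub_le (hlam : 0 < lam) (hlam' : lam ≤ 1)
    (hactm : Measurable fun q : G × M => act q.1 q.2)
    (hc0 : ∀ g : G, 0 ≤ c g)
    (hcLip : ∀ (g : G) (x y : M), dist (act g x) (act g y) ≤ c g * dist x y)
    (hξm : Measurable fun q : G × M => ξ q.1 q.2) {s : ℝ} (hs : 0 ≤ s) {S : G → ℝ}
    (hS0 : ∀ g, 0 ≤ S g)
    (hRS : ∀ (g : G) (x y : M),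
      |ξ g x - ξ g y| ≤ S g * dist x y * (1 + dist x x₀ + dist y x₀) ^ s)
    (hsγ : s + 1 ≤ γ)
    (hδ : Integrable (fun g => deltaFun x₀ act c lam g ^ (γ + 1)) π)
    (hcδ : Integrable (fun g => c g * deltaFun x₀ act c lam g ^ (2 * γ)) π)
    (hSδ : Integrable (fun g => S g * deltaFun x₀ act c lam g ^ (γ + 1)) π)
    {f : M → ℂ} (hf : Measurable f) {A a t : ℝ} (hA : 0 ≤ A) (ha : 0 ≤ a)
    (hfA : ∀ x, ‖f x‖ ≤ A * pfun x₀ lam x ^ (γ + 1))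
    {Φ : M × M → ℝ≥0∞}
    (hfΦ : ∀ x y, ‖f x - f y‖ₑ ≤ Φ (x, y) + ENNReal.ofReal (a * wDelta x₀ lam γ x y))
    (x y : M) :
    ‖Pt π act ξ t f x - Pt π act ξ t f y‖ₑ
      ≤ ∫⁻ g, Φ (act g x, act g y) ∂π
        + ENNReal.ofReal ((a * (∫ g, c g * deltaFun x₀ act c lam g ^ (2 * γ) ∂π)
          + |t| * A * ((2 / lam) ^ s * ∫ g, S g * deltaFun x₀ act c lam g ^ (γ + 1) ∂π))
          * wDelta x₀ lam γ x y) := by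
  have hγ : 0 ≤ γ := by linarith
  have hw : 0 ≤ wDelta x₀ lam γ x y := wDelta_nonneg hlam.le γ x y
  have hδ0 (g : G) : 0 ≤ deltaFun x₀ act c lam g := (deltaFun_pos hlam.le g).le
  have hp0 (z : M) : 0 ≤ pfun x₀ lam z := (pfun_pos hlam.le z).le
  set E : G → ℝ := fun g => (a * (c g * deltaFun x₀ act c lam g ^ (2 * γ))
    + |t| * A * ((2 / lam) ^ s * (S g * deltaFun x₀ act c lam g ^ (γ + 1))))
      * wDelta x₀ lam γ x y with hE
  have hE0 (g : G) : 0 ≤ E g := by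
    have h1 := hc0 g
    have h2 := hS0 g
    have h3 := Real.rpow_nonneg (hδ0 g) (2 * γ)
    have h4 := Real.rpow_nonneg (hδ0 g) (γ + 1)
    simp only [hE]
    positivity
  have hi1 := hcδ.const_mul a
  have hi2 := (hSδ.const_mul ((2 / lam) ^ s)).const_mul (|t| * A)
  have hEi : Integrable E π := (hi1.add hi2).mul_const _
  have hEint : ∫⁻ g, ENNReal.ofReal (E g) ∂π
      = ENNReal.ofReal ((a * (∫ g, c g * deltaFun x₀ act c lam g ^ (2 * γ) ∂π)
          + |t| * A * ((2 / lam) ^ s * ∫ g, S g * deltaFun x₀ act c lam g ^ (γ + 1) ∂π))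
          * wDelta x₀ lam γ x y) := by
    rw [← ofReal_integral_eq_lintegral_ofReal hEi (ae_of_all _ hE0), hE, integral_mul_const,
      integral_add hi1 hi2, integral_const_mul, integral_const_mul, integral_const_mul]
  rw [← hEint, ← lintegral_add_right' _ hEi.1.aemeasurable.ennreal_ofReal, Pt, Pt,
    ← integral_sub (integrable_exp_mul_act hlam.le hactm hcLip hγ hξm hδ hf hA hfA t x)
      (integrable_exp_mul_act hlam.le hactm hcLip hγ hξm hδ hf hA hfA t y)]
  refine (enorm_integral_le_lintegral_enorm _).trans (lintegral_mono fun g => ?_)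
  have hmin : min ‖f (act g x)‖ ‖f (act g y)‖ ≤ A * deltaFun x₀ act c lam g ^ (γ + 1)
      * min (pfun x₀ lam x) (pfun x₀ lam y) ^ (γ + 1) := by
    have h1 := norm_act_le hlam.le hcLip hγ hA hfA g x
    have h2 := norm_act_le hlam.le hcLip hγ hA hfA g y
    rw [← mul_assoc] at h1 h2
    rcases min_choice (pfun x₀ lam x) (pfun x₀ lam y) with h | h <;> rw [h]
    · exact (min_le_left _ _).trans h1
    · exact (min_le_right _ _).trans h2
  have hosc : |t * ξ g x - t * ξ g y| * min ‖f (act g x)‖ ‖f (act g y)‖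
      ≤ |t| * A * ((2 / lam) ^ s * (S g * deltaFun x₀ act c lam g ^ (γ + 1)))
        * wDelta x₀ lam γ x y := by
    have h4 := Real.rpow_nonneg (hδ0 g) (γ + 1)
    have h2 := hS0 g
    rw [← mul_sub, abs_mul]
    calc |t| * |ξ g x - ξ g y| * min ‖f (act g x)‖ ‖f (act g y)‖
        ≤ |t| * (S g * dist x y * (1 + dist x x₀ + dist y x₀) ^ s)
          * (A * deltaFun x₀ act c lam g ^ (γ + 1)
            * min (pfun x₀ lam x) (pfun x₀ lam y) ^ (γ + 1)) := by
          gcongr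
          exact hRS g x y
      _ = |t| * A * (S g * deltaFun x₀ act c lam g ^ (γ + 1))
          * (dist x y * (1 + dist x x₀ + dist y x₀) ^ s
            * min (pfun x₀ lam x) (pfun x₀ lam y) ^ (γ + 1)) := by
          ring
      _ ≤ |t| * A * (S g * deltaFun x₀ act c lam g ^ (γ + 1))
          * ((2 / lam) ^ s * wDelta x₀ lam γ x y) := by
          exact mul_le_mul_of_nonneg_left
            (dist_mul_rpow_mul_min_rpow_le hlam hlam' hs hsγ x y) (by positivity)
      _ = _ := by ring
  have hlip : a * wDelta x₀ lam γ (act g x) (act g y)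
      ≤ a * (c g * deltaFun x₀ act c lam g ^ (2 * γ)) * wDelta x₀ lam γ x y := by
    rw [mul_assoc]
    exact mul_le_mul_of_nonneg_left (wDelta_act_le hlam.le hc0 hcLip hγ le_rfl g x y) ha
  have hpt := norm_exp_mul_sub_exp_mul_le (t * ξ g x) (t * ξ g y) (f (act g x)) (f (act g y))
  push_cast at hpt
  calc ‖Complex.exp (Complex.I * (t * ξ g x)) * f (act g x)
        - Complex.exp (Complex.I * (t * ξ g y)) * f (act g y)‖ₑ
      ≤ ‖f (act g x) - f (act g y)‖ₑ
        + ENNReal.ofReal (|t * ξ g x - t * ξ g y| * min ‖f (act g x)‖ ‖f (act g y)‖) := by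
        rw [← ofReal_norm, ← ofReal_norm, ← ENNReal.ofReal_add (norm_nonneg _) (by positivity)]
        exact ENNReal.ofReal_le_ofReal hpt
    _ ≤ Φ (act g x, act g y) + ENNReal.ofReal (a * wDelta x₀ lam γ (act g x) (act g y))
        + ENNReal.ofReal (|t| * A * ((2 / lam) ^ s * (S g * deltaFun x₀ act c lam g ^ (γ + 1)))
          * wDelta x₀ lam γ x y) :=
        add_le_add (hfΦ _ _) (ENNReal.ofReal_le_ofReal hosc)
    _ ≤ Φ (act g x, act g y) + ENNReal.ofReal (E g) := by
        have h4 := Real.rpow_nonneg (hδ0 g) (γ + 1)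
        have h2 := hS0 g
        have h1 := wDelta_nonneg (x₀ := x₀) hlam.le γ (act g x) (act g y)
        rw [add_assoc, ← ENNReal.ofReal_add (by positivity) (by positivity)]
        refine add_le_add_right (ENNReal.ofReal_le_ofReal ?_) _
        simp only [hE, add_mul]
        linarith

theorem exists_enorm_iterate_Pt_sub_le [BorelSpace M] [IsProbabilityMeasure π]
    [SecondCountableTopology M] [Semigroup G] [MeasurableMul₂ G]
    (hlam : 0 < lam) (hlam' : lam ≤ 1)
    (hact : ∀ (g h : G) (x : M), act (g * h) x = act g (act h x))
    (hactm : Measurable fun q : G × M => act q.1 q.2)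
    (hc0 : ∀ g : G, 0 ≤ c g)
    (hcLip : ∀ (g : G) (x y : M), dist (act g x) (act g y) ≤ c g * dist x y)
    (hξm : Measurable fun q : G × M => ξ q.1 q.2) {s : ℝ} (hs : 0 ≤ s) {S : G → ℝ}
    (hS0 : ∀ g, 0 ≤ S g)
    (hRS : ∀ (g : G) (x y : M),
      |ξ g x - ξ g y| ≤ S g * dist x y * (1 + dist x x₀ + dist y x₀) ^ s)
    (hsγ : s + 1 ≤ γ)
    (hδ : Integrable (fun g => deltaFun x₀ act c lam g ^ (γ + 1)) π)
    (hcδ : Integrable (fun g => c g * deltaFun x₀ act c lam g ^ (2 * γ)) π)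
    (hSδ : Integrable (fun g => S g * deltaFun x₀ act c lam g ^ (γ + 1)) π) (n : ℕ) :
    ∃ C : ℝ, 0 ≤ C ∧ ∀ (t : ℝ) (f : M → ℂ), Measurable f → ∀ A a : ℝ, 0 ≤ A → 0 ≤ a →
      (∀ x, ‖f x‖ ≤ A * pfun x₀ lam x ^ (γ + 1)) → ∀ Φ : M × M → ℝ≥0∞, Measurable Φ →
      (∀ x y, ‖f x - f y‖ₑ ≤ Φ (x, y) + ENNReal.ofReal (a * wDelta x₀ lam γ x y)) →
      ∀ x y, ‖(Pt π act ξ t)^[n + 1] f x - (Pt π act ξ t)^[n + 1] f y‖ₑ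
        ≤ ∫⁻ g, Φ (act g x, act g y) ∂(piStar π n)
          + ENNReal.ofReal (C * (a + |t| * A) * wDelta x₀ lam γ x y) := by
  have hγ : 0 ≤ γ := by linarith
  have hδ0 (g : G) : 0 ≤ deltaFun x₀ act c lam g := (deltaFun_pos hlam.le g).le
  have hstep {f : M → ℂ} (hf : Measurable f) {A a t : ℝ} (hA : 0 ≤ A) (ha : 0 ≤ a)
      (hfA : ∀ x, ‖f x‖ ≤ A * pfun x₀ lam x ^ (γ + 1)) {Φ : M × M → ℝ≥0∞}
      (hfΦ : ∀ x y, ‖f x - f y‖ₑ ≤ Φ (x, y) + ENNReal.ofReal (a * wDelta x₀ lam γ x y))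
      (x y : M) :=
    enorm_Pt_sub_le hlam hlam' hactm hc0 hcLip hξm hs hS0 hRS hsγ hδ hcδ hSδ hf (t := t)
      hA ha hfA hfΦ x y
  have hK₁ : 0 ≤ ∫ g, c g * deltaFun x₀ act c lam g ^ (2 * γ) ∂π :=
    integral_nonneg fun g => mul_nonneg (hc0 g) (Real.rpow_nonneg (hδ0 g) _)
  have hK₂ : 0 ≤ (2 / lam) ^ s * ∫ g, S g * deltaFun x₀ act c lam g ^ (γ + 1) ∂π :=
    mul_nonneg (by positivity)
      (integral_nonneg fun g => mul_nonneg (hS0 g) (Real.rpow_nonneg (hδ0 g) _))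
  have hD : 0 ≤ ∫ g, deltaFun x₀ act c lam g ^ (γ + 1) ∂π :=
    integral_nonneg fun g => Real.rpow_nonneg (hδ0 g) _
  generalize hK₁e : ∫ g, c g * deltaFun x₀ act c lam g ^ (2 * γ) ∂π = K₁ at *
  generalize hK₂e : (2 / lam) ^ s * ∫ g, S g * deltaFun x₀ act c lam g ^ (γ + 1) ∂π = K₂ at *
  generalize hDe : ∫ g, deltaFun x₀ act c lam g ^ (γ + 1) ∂π = D at *
  induction n with
  | zero =>
    refine ⟨K₁ + K₂, by positivity, fun t f hf A a hA ha hfA Φ hΦ hfΦ x y => ?_⟩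
    refine (hstep hf hA ha hfA hfΦ x y).trans (add_le_add_right (ENNReal.ofReal_le_ofReal ?_) _)
    refine mul_le_mul_of_nonneg_right ?_ (wDelta_nonneg hlam.le γ x y)
    have h1 : 0 ≤ |t| * A * K₁ := by positivity
    have h2 : 0 ≤ a * K₂ := by positivity
    linarith
  | succ n ih =>
    obtain ⟨C, hC, ih⟩ := ih
    refine ⟨C * (K₁ + K₂ + D), by positivity, fun t f hf A a hA ha hfA Φ hΦ hfΦ x y => ?_⟩
    have hΦ' : Measurable fun q : G × (M × M) => Φ (act q.1 q.2.1, act q.1 q.2.2) :=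
      hΦ.comp ((hactm.comp (measurable_fst.prodMk measurable_snd.fst)).prodMk
        (hactm.comp (measurable_fst.prodMk measurable_snd.snd)))
    have hQ : Measurable fun z : M × M => ∫⁻ g, Φ (act g z.1, act g z.2) ∂π :=
      hΦ'.lintegral_prod_left'
    have hPA (z : M) : ‖Pt π act ξ t f z‖ ≤ A * D * pfun x₀ lam z ^ (γ + 1) := by
      rw [← hDe]
      exact norm_Pt_le_mul_rpow hlam.le hcLip hγ hδ hA hfA t z
    have h := ih t (Pt π act ξ t f) (measurable_Pt hactm hξm t hf) (A * D)
      (a * K₁ + |t| * A * K₂) (by positivity) (by positivity) hPA _ hQ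
      (hstep hf hA ha hfA hfΦ) x y
    have hm : Measurable fun g => Φ (act g x, act g y) :=
      hΦ'.comp (measurable_id.prodMk (measurable_const (a := (x, y))))
    rw [Function.iterate_succ_apply, lintegral_piStar_succ n hm]
    simp only [hact]
    refine h.trans (add_le_add_right (ENNReal.ofReal_le_ofReal ?_) _)
    refine mul_le_mul_of_nonneg_right ?_ (wDelta_nonneg hlam.le γ x y)
    rw [mul_assoc C]
    refine mul_le_mul_of_nonneg_left ?_ hC
    have h1 : 0 ≤ |t| * A * K₁ := by positivity
    have h2 : 0 ≤ a * K₂ := by positivity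
    have h3 : 0 ≤ a * D := by positivity
    linarith

end Perturbation

/-- Lemma 7.3. `piStar π n₀ = π^{*(n₀+1)}`, so `κ₀ = ϑ₀^{1/(n₀+1)}` and
`P(t)^{n₀+1}` here correspond to the paper's `ϑ₀^{1/n₀}` and `P(t)^{n₀}`. -/
theorem stmt12
    {M : Type*} [MetricSpace M] [ProperSpace M] [MeasurableSpace M] [BorelSpace M]
    {G : Type*} [Semigroup G] [MeasurableSpace G] [MeasurableMul₂ G]
    (x₀ : M) (act : G → M → M)
    (hact : ∀ (g h : G) (x : M), act (g * h) x = act g (act h x))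
    (hactm : Measurable fun q : G × M => act q.1 q.2)
    (c : G → ℝ) (hcm : Measurable c)
    (hc0 : ∀ g : G, 0 ≤ c g)
    (hcLip : ∀ (g : G) (x y : M), dist (act g x) (act g y) ≤ c g * dist x y)
    (hcMin : ∀ (g : G) (K : ℝ), 0 ≤ K →
      (∀ x y : M, dist (act g x) (act g y) ≤ K * dist x y) → c g ≤ K)
    (π : Measure G) [IsProbabilityMeasure π]
    -- condition 𝓗(γ₀)
    (γ₀ : ℝ) (hγ₀ : 0 < γ₀) (n₀ : ℕ)
    (hM : ∫⁻ g, ENNReal.ofReal (deltaTilde x₀ act c g ^ (γ₀ + 1)) ∂π < ⊤)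
    (hM' : ∫⁻ g, ENNReal.ofReal (c g * deltaTilde x₀ act c g ^ (2 * γ₀)) ∂π < ⊤)
    (hC : ∫⁻ g, ENNReal.ofReal (c g * max (c g) 1 ^ (2 * γ₀)) ∂(piStar π n₀) < 1)
    -- `λ₀ ∈ (0,1]` with `ϑ₀ < 1`
    (lam₀ : ℝ) (hlam₀ : 0 < lam₀) (hlam₀' : lam₀ ≤ 1)
    (hθint : Integrable (fun g => c g * deltaFun x₀ act c lam₀ g ^ (2 * γ₀)) (piStar π n₀))
    (hθ : theta0 x₀ act c π lam₀ γ₀ n₀ < 1)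
    -- the `P`-invariant probability measure
    (ν : Measure M) [IsProbabilityMeasure ν]
    (hν : Measure.map (fun q : G × M => act q.1 q.2) (π.prod ν) = ν)
    -- condition RS
    (ξ : G → M → ℝ) (hξm : Measurable fun q : G × M => ξ q.1 q.2)
    (r s : ℝ) (hr : 0 ≤ r) (hs : 0 ≤ s)
    (R S : G → ℝ) (hRm : Measurable R) (hSm : Measurable S)
    (hR0 : ∀ g, 0 ≤ R g) (hS0 : ∀ g, 0 ≤ S g)
    (hRS1 : ∀ (g : G) (x : M), |ξ g x| ≤ R g * (1 + dist x x₀) ^ r)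
    (hRS2 : ∀ (g : G) (x y : M),
      |ξ g x - ξ g y| ≤ S g * dist x y * (1 + dist x x₀ + dist y x₀) ^ s)
    -- hypotheses on `γ` and `κ₀'`
    (γ : ℝ) (hsγ : s + 1 ≤ γ) (hγγ₀ : γ ≤ γ₀)
    (hIS : ∫⁻ g, ENNReal.ofReal (S g * deltaFun x₀ act c lam₀ g ^ (γ + 1)) ∂π < ⊤)
    (κ₀' : ℝ)
    (hκ₁ : theta0 x₀ act c π lam₀ γ₀ n₀ ^ (1 / ((n₀ : ℝ) + 1)) < κ₀') (hκ₂ : κ₀' < 1) :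
    -- (i)
    (∀ (t : ℝ) (n : ℕ), 1 ≤ n → ∀ f : M → ℂ, memB x₀ lam₀ γ f →
      (∫ x, ‖(Pt π act ξ t)^[n] f x‖ ∂ν) ≤ ∫ x, ‖f x‖ ∂ν) ∧
    -- (ii)
    (∃ J : ℝ, 0 ≤ J ∧ ∃ ι : ℝ, 0 < ι ∧ ∀ t : ℝ, |t| < ι →
      ∀ f : M → ℂ, memB x₀ lam₀ γ f →
        mGam x₀ lam₀ γ ((Pt π act ξ t)^[n₀ + 1] f)
            + ∫ x, ‖(Pt π act ξ t)^[n₀ + 1] f x‖ ∂ν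
          ≤ κ₀' ^ (n₀ + 1) * (mGam x₀ lam₀ γ f + ∫ x, ‖f x‖ ∂ν)
            + J * ∫ x, ‖f x‖ ∂ν) ∧
    -- (iii)
    (∃ φ : ℝ → ℝ, Continuous φ ∧ (∀ t, 0 ≤ φ t) ∧ φ 0 = 0 ∧
      ∀ (t : ℝ) (f : M → ℂ), memB x₀ lam₀ γ f →
        (∫ x, ‖Pt π act ξ t f x - Pop π act f x‖ ∂ν)
          ≤ φ t * (mGam x₀ lam₀ γ f + ∫ x, ‖f x‖ ∂ν)) := by
  have hγ : 0 ≤ γ := by linarith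
  have hδ0 (g : G) : 0 ≤ deltaFun x₀ act c lam₀ g := (deltaFun_pos hlam₀.le g).le
  have hδ1 (g : G) : 1 ≤ deltaFun x₀ act c lam₀ g := one_le_deltaFun hlam₀.le g
  have hδm : Measurable (deltaFun x₀ act c lam₀) := measurable_deltaFun hactm hcm
  have hδt (g : G) : deltaFun x₀ act c lam₀ g ≤ deltaTilde x₀ act c g :=
    deltaFun_le_deltaTilde hlam₀' (hc0 g)
  -- integrability of the weights
  have hδγ₀ : ∫⁻ g, ENNReal.ofReal (deltaFun x₀ act c lam₀ g ^ (γ₀ + 1)) ∂π < ⊤ := by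
    refine lt_of_le_of_lt (lintegral_mono fun g => ENNReal.ofReal_le_ofReal ?_) hM
    exact Real.rpow_le_rpow (hδ0 g) (hδt g) (by linarith)
  have hδ : Integrable (fun g => deltaFun x₀ act c lam₀ g ^ (γ + 1)) π := by
    have hm : Measurable fun g => deltaFun x₀ act c lam₀ g ^ (γ + 1) := hδm.pow_const _
    refine (lintegral_ofReal_ne_top_iff_integrable hm.aestronglyMeasurable
      (ae_of_all _ fun g => Real.rpow_nonneg (hδ0 g) _)).1
      (lt_of_le_of_lt (lintegral_mono fun g => ENNReal.ofReal_le_ofReal ?_) hδγ₀).ne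
    exact Real.rpow_le_rpow_of_exponent_le (hδ1 g) (by linarith)
  have hcδ : Integrable (fun g => c g * deltaFun x₀ act c lam₀ g ^ (2 * γ)) π := by
    have hm : Measurable fun g => c g * deltaFun x₀ act c lam₀ g ^ (2 * γ) :=
      hcm.mul (hδm.pow_const _)
    refine (lintegral_ofReal_ne_top_iff_integrable hm.aestronglyMeasurable
      (ae_of_all _ fun g => mul_nonneg (hc0 g) (Real.rpow_nonneg (hδ0 g) _))).1
      (lt_of_le_of_lt (lintegral_mono fun g => ENNReal.ofReal_le_ofReal ?_) hM').ne
    refine mul_le_mul_of_nonneg_left ?_ (hc0 g)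
    exact (Real.rpow_le_rpow_of_exponent_le (hδ1 g) (by linarith)).trans
      (Real.rpow_le_rpow (hδ0 g) (hδt g) (by linarith))
  have hSδ : Integrable (fun g => S g * deltaFun x₀ act c lam₀ g ^ (γ + 1)) π := by
    have hm : Measurable fun g => S g * deltaFun x₀ act c lam₀ g ^ (γ + 1) :=
      hSm.mul (hδm.pow_const _)
    exact (lintegral_ofReal_ne_top_iff_integrable hm.aestronglyMeasurable
      (ae_of_all _ fun g => mul_nonneg (hS0 g) (Real.rpow_nonneg (hδ0 g) _))).1 hIS.ne
  -- moments of the invariant measure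
  have hνγ₀ : Integrable (fun x => pfun x₀ lam₀ x ^ (γ₀ + 1)) ν := by
    refine integrable_pfun_rpow_of_invariant hlam₀.le hactm hcm hc0 hcLip
      (lintegral_act_piStar hact hactm hν n₀) (by linarith)
      (lintegral_piStar_lt_top (hδm.pow_const _).ennreal_ofReal (fun g h => ?_) hδγ₀ n₀)
      (lt_of_le_of_lt (lintegral_mono fun g => ENNReal.ofReal_le_ofReal ?_) hC)
    · rw [← ENNReal.ofReal_mul (Real.rpow_nonneg (hδ0 g) _), ← Real.mul_rpow (hδ0 g) (hδ0 h)]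
      exact ENNReal.ofReal_le_ofReal (Real.rpow_le_rpow (hδ0 _)
        (deltaFun_mul_le hlam₀.le hact hc0 hcLip hcMin g h) (by linarith))
    · rw [add_comm, Real.rpow_add_of_nonneg (hc0 g) zero_le_one hγ₀.le, Real.rpow_one]
      refine mul_le_mul_of_nonneg_left ?_ (hc0 g)
      exact (Real.rpow_le_rpow (hc0 g) (le_max_left _ _) hγ₀.le).trans
        (Real.rpow_le_rpow_of_exponent_le (le_max_right _ _) (by linarith))
  have hpm : Measurable fun x => pfun x₀ lam₀ x ^ (γ + 1) :=
    (continuous_pfun_rpow hlam₀.le _).measurable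
  have hp0 (x : M) : 0 ≤ pfun x₀ lam₀ x ^ (γ + 1) := Real.rpow_nonneg (pfun_pos hlam₀.le x).le _
  have hνγ : Integrable (fun x => pfun x₀ lam₀ x ^ (γ + 1)) ν := by
    refine hνγ₀.mono' hpm.aestronglyMeasurable (ae_of_all _ fun x => ?_)
    rw [Real.norm_of_nonneg (hp0 x)]
    exact Real.rpow_le_rpow_of_exponent_le (one_le_pfun hlam₀.le x) (by linarith)
  obtain ⟨L, hL, hgrowth⟩ : ∃ L : ℝ, 0 ≤ L ∧ ∀ f : M → ℂ, memB x₀ lam₀ γ f → ∀ x,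
      ‖f x‖ ≤ L * (mGam x₀ lam₀ γ f + ∫ y, ‖f y‖ ∂ν) * pfun x₀ lam₀ x ^ (γ + 1) :=
    ⟨_, add_nonneg zero_le_one (div_nonneg (integral_nonneg hp0) hlam₀.le),
      fun f hf x => hf.norm_le_mul_rpow hlam₀ hγ hνγ x⟩
  have hmeas {f : M → ℂ} (hf : memB x₀ lam₀ γ f) : Measurable f :=
    (hf.continuous hlam₀.le).measurable
  have hnorm (t : ℝ) (n : ℕ) {f : M → ℂ} (hf : memB x₀ lam₀ γ f) :
      ∫ x, ‖(Pt π act ξ t)^[n] f x‖ ∂ν ≤ ∫ x, ‖f x‖ ∂ν :=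
    integral_norm_iterate_Pt_le hactm hν hξm t n (hmeas hf) (hf.integrable hlam₀ hνγ)
  have hm0 (f : M → ℂ) : 0 ≤ mGam x₀ lam₀ γ f := mGam_nonneg hlam₀.le
  have hF0 (f : M → ℂ) : 0 ≤ ∫ x, ‖f x‖ ∂ν := integral_nonneg fun x => norm_nonneg _
  refine ⟨fun t n _ f hf => hnorm t n hf, ?_, ?_⟩
  · obtain ⟨C, hC0, hCt⟩ := exists_enorm_iterate_Pt_sub_le hlam₀ hlam₀' hact hactm hc0 hcLip hξm hs
      hS0 hRS2 hsγ hδ hcδ hSδ n₀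
    have hϑ0 : 0 ≤ theta0 x₀ act c π lam₀ γ₀ n₀ :=
      integral_nonneg fun g => mul_nonneg (hc0 g) (Real.rpow_nonneg (hδ0 g) _)
    have hϑκ : theta0 x₀ act c π lam₀ γ₀ n₀ < κ₀' ^ (n₀ + 1) := by
      have h := pow_lt_pow_left₀ hκ₁ (Real.rpow_nonneg hϑ0 _) (Nat.succ_ne_zero n₀)
      rw [one_div, ← Nat.cast_add_one, Real.rpow_inv_natCast_pow hϑ0 n₀.succ_ne_zero] at h
      exact h
    have hCL : 0 < C * L + 1 := by positivity
    refine ⟨1, zero_le_one, (κ₀' ^ (n₀ + 1) - theta0 x₀ act c π lam₀ γ₀ n₀) / (C * L + 1),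
      div_pos (sub_pos.2 hϑκ) hCL, fun t ht f hf => ?_⟩
    rw [lt_div_iff₀ hCL] at ht
    have hmG : mGam x₀ lam₀ γ ((Pt π act ξ t)^[n₀ + 1] f)
        ≤ theta0 x₀ act c π lam₀ γ₀ n₀ * mGam x₀ lam₀ γ f
          + C * (|t| * (L * (mGam x₀ lam₀ γ f + ∫ x, ‖f x‖ ∂ν))) := by
      have hN0 := add_nonneg (hm0 f) (hF0 f)
      have hm0f := hm0 f
      refine mGam_le hlam₀.le (by positivity) fun x y => ?_
      have hw := wDelta_nonneg (x₀ := x₀) hlam₀.le γ x y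
      have hwm : Measurable fun z : M × M =>
          ENNReal.ofReal (mGam x₀ lam₀ γ f * wDelta x₀ lam₀ γ z.1 z.2) := by
        have hp := (continuous_pfun_rpow (x₀ := x₀) hlam₀.le γ).measurable
        unfold wDelta
        exact (((measurable_dist.mul (hp.comp measurable_fst)).mul
          (hp.comp measurable_snd)).const_mul _).ennreal_ofReal
      have h := hCt t f (hmeas hf) _ 0 (by positivity) le_rfl (hgrowth f hf) _ hwm
        (fun x y => by
          rw [zero_mul, ENNReal.ofReal_zero, add_zero, ← ofReal_norm]
          exact ENNReal.ofReal_le_ofReal (hf.norm_sub_le hlam₀.le x y)) x y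
      have hfint : ∫⁻ g, ENNReal.ofReal (mGam x₀ lam₀ γ f
            * wDelta x₀ lam₀ γ (act g x) (act g y)) ∂(piStar π n₀)
          ≤ ENNReal.ofReal (theta0 x₀ act c π lam₀ γ₀ n₀ * mGam x₀ lam₀ γ f
            * wDelta x₀ lam₀ γ x y) := by
        have he : theta0 x₀ act c π lam₀ γ₀ n₀ * mGam x₀ lam₀ γ f * wDelta x₀ lam₀ γ x y
            = ∫ g, c g * deltaFun x₀ act c lam₀ g ^ (2 * γ₀)
              * (mGam x₀ lam₀ γ f * wDelta x₀ lam₀ γ x y) ∂(piStar π n₀) := by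
          rw [integral_mul_const, theta0, mul_assoc]
        rw [he, ofReal_integral_eq_lintegral_ofReal (hθint.mul_const _)
          (ae_of_all _ fun g => mul_nonneg
            (mul_nonneg (hc0 g) (Real.rpow_nonneg (hδ0 g) _)) (mul_nonneg hm0f hw))]
        refine lintegral_mono fun g => ENNReal.ofReal_le_ofReal ?_
        rw [mul_left_comm]
        exact mul_le_mul_of_nonneg_left (wDelta_act_le hlam₀.le hc0 hcLip hγ hγγ₀ g x y) hm0f
      have h' := h.trans (add_le_add_left hfint _)
      rw [zero_add, ← ENNReal.ofReal_add (by positivity) (by positivity), ← add_mul,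
        ← ofReal_norm] at h'
      exact (ENNReal.ofReal_le_ofReal_iff (by positivity)).1 h'
    have hF := hnorm t (n₀ + 1) hf
    have htCL : C * (|t| * L) ≤ κ₀' ^ (n₀ + 1) - theta0 x₀ act c π lam₀ γ₀ n₀ := by
      have := abs_nonneg t
      nlinarith
    have h1 := mul_le_mul_of_nonneg_right htCL (add_nonneg (hm0 f) (hF0 f))
    have h2 := mul_nonneg hϑ0 (hF0 f)
    linarith
  · have hprod : Integrable (fun q : G × M => pfun x₀ lam₀ (act q.1 q.2) ^ (γ + 1)) (π.prod ν) := by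
      rw [← hν] at hνγ
      exact hνγ.comp_measurable hactm
    have hbd (t r : ℝ) : ‖Complex.exp (Complex.I * (t * r)) - 1‖ ≤ 2 := by
      refine (norm_sub_le _ _).trans ?_
      rw [mul_comm, ← Complex.ofReal_mul, Complex.norm_exp_ofReal_mul_I, norm_one]
      norm_num
    set H : ℝ → G × M → ℝ := fun t q => ‖Complex.exp (Complex.I * (t * ξ q.1 q.2)) - 1‖
      * pfun x₀ lam₀ (act q.1 q.2) ^ (γ + 1) with hH
    have hH0 (t : ℝ) (q : G × M) : 0 ≤ H t q := mul_nonneg (norm_nonneg _) (hp0 _)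
    have hHm (t : ℝ) : Measurable (H t) := by
      have h1 : Measurable fun q : G × M => (ξ q.1 q.2 : ℂ) := Complex.measurable_ofReal.comp hξm
      exact ((Complex.measurable_exp.comp ((h1.const_mul _).const_mul _)).sub_const 1).norm.mul
        (hpm.comp hactm)
    have hHle (t : ℝ) (q : G × M) : ‖H t q‖ ≤ 2 * pfun x₀ lam₀ (act q.1 q.2) ^ (γ + 1) := by
      rw [Real.norm_of_nonneg (hH0 t q)]
      exact mul_le_mul_of_nonneg_right (hbd _ _) (hp0 _)
    have hHi (t : ℝ) : Integrable (H t) (π.prod ν) :=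
      (hprod.const_mul 2).mono' (hHm t).aestronglyMeasurable (ae_of_all _ (hHle t))
    refine ⟨fun t => L * ∫ q, H t q ∂(π.prod ν), ?_,
      fun t => mul_nonneg hL (integral_nonneg (hH0 t)), ?_, fun t f hf => ?_⟩
    · refine Continuous.const_mul ?_ L
      refine continuous_of_dominated (fun t => (hHm t).aestronglyMeasurable)
        (fun t => ae_of_all _ (hHle t)) (hprod.const_mul 2) (ae_of_all _ fun q => ?_)
      simp only [hH]
      fun_prop
    · simp [hH]
    · have hN0 := mul_nonneg hL (add_nonneg (hm0 f) (hF0 f))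
      have hfa (x : M) : Integrable (fun g => f (act g x)) π := by
        have := integrable_exp_mul_act hlam₀.le hactm hcLip hγ hξm hδ (hmeas hf) hN0
          (hgrowth f hf) 0 x
        simpa using this
      have hpt : ∀ᵐ x ∂ν, ‖Pt π act ξ t f x - Pop π act f x‖
          ≤ L * (mGam x₀ lam₀ γ f + ∫ y, ‖f y‖ ∂ν) * ∫ g, H t (g, x) ∂π := by
        filter_upwards [(hHi t).prod_left_ae] with x hx
        rw [Pt, Pop, ← integral_sub (integrable_exp_mul_act hlam₀.le hactm hcLip hγ hξm hδ
          (hmeas hf) hN0 (hgrowth f hf) t x) (hfa x), ← integral_const_mul]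
        refine norm_integral_le_of_norm_le (hx.const_mul _) (ae_of_all _ fun g => ?_)
        rw [← sub_one_mul, norm_mul]
        calc ‖Complex.exp (Complex.I * (t * ξ g x)) - 1‖ * ‖f (act g x)‖
            ≤ ‖Complex.exp (Complex.I * (t * ξ g x)) - 1‖
              * (L * (mGam x₀ lam₀ γ f + ∫ y, ‖f y‖ ∂ν) * pfun x₀ lam₀ (act g x) ^ (γ + 1)) :=
              mul_le_mul_of_nonneg_left (hgrowth f hf _) (norm_nonneg _)
          _ = _ := by
              simp only [hH]
              ring
      calc ∫ x, ‖Pt π act ξ t f x - Pop π act f x‖ ∂ν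
          ≤ ∫ x, L * (mGam x₀ lam₀ γ f + ∫ y, ‖f y‖ ∂ν) * ∫ g, H t (g, x) ∂π ∂ν :=
            integral_mono_of_nonneg (ae_of_all _ fun _ => norm_nonneg _)
              ((hHi t).integral_prod_right.const_mul _) hpt
        _ = _ := by
            rw [integral_const_mul, ← integral_prod_symm _ (hHi t)]
            ring

end
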